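/- Suppose M is totally real, so that r = n − 1. Let t := |E_p ∖ S_p|. Assume the p-adic Schanuel Conjecture. Then rk((log_p(σ_i(g_j(ε))))_{σ_i ∈ S_p, g_j ∈ G}) = r − (t−1)^+. -/

import Mathlib

open scoped NumberField
open Filter

/-- The `p`-adic logarithm on a complete normed field `Cp` (a stand-in for `ℂ_p`), defined by
the power series `log_p x = ∑_{k ≥ 1} (-1)^(k+1) (x-1)^k / k` (convergent for `‖x - 1‖ < 1`). -/
noncomputable def plog (Cp : Type*) [NormedField Cp] (x : Cp) : Cp :=
  ∑' k : ℕ, (-1) ^ (k + 1 + 1) * (x - 1) ^ (k + 1) / ((k : Cp) + 1)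

/-- The `p`-adic Schanuel conjecture. -/
def PadicSchanuel (Cp : Type*) [NormedField Cp] [CharZero Cp] : Prop :=
  ∀ (m : ℕ) (α : Fin m → Cp),
    (∀ i, IsAlgebraic ℚ (α i)) → (∀ i, ‖α i - 1‖ < 1) →
    LinearIndependent ℚ (fun i => plog Cp (α i)) →
    AlgebraicIndependent ℚ (fun i => plog Cp (α i))

/-- The matrix `(log_p (σ (g ε)))` with rows indexed by `S_p ⊆ E_p` and columns by `G`. -/
noncomputable def padicLogMatrix (Cp : Type*) [NormedField Cp] (M : Type*) [Field M]
    [NumberField M] (S : Set (M →+* Cp)) (ε : M) : Matrix S (M ≃ₐ[ℚ] M) Cp :=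
  fun σ g => plog Cp (σ.1 (g ε))

/-- `ε ∈ O_M^*` is a weak Minkowski unit. -/
def IsWeakMinkowskiUnit (M : Type*) [Field M] [NumberField M] (ε : (𝓞 M)ˣ) : Prop :=
  ∃ u : (M ≃ₐ[ℚ] M) → (𝓞 M)ˣ,
    (∀ g, algebraMap (𝓞 M) M (u g) = g (algebraMap (𝓞 M) M ε)) ∧
    (Subgroup.closure (Set.range u)).FiniteIndex

section PadicLog

variable {p : ℕ} [Fact p.Prime] {Cp : Type*} [NormedField Cp] [Algebra ℚ_[p] Cp]

theorem norm_natCast_eq_padic (hpadic : ∀ x : ℚ_[p], ‖algebraMap ℚ_[p] Cp x‖ = ‖x‖) (k : ℕ) :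
    ‖(k : Cp)‖ = ‖(k : ℚ_[p])‖ := by
  rw [← hpadic, map_natCast]

theorem norm_natCast_le_one_of_padic (hpadic : ∀ x : ℚ_[p], ‖algebraMap ℚ_[p] Cp x‖ = ‖x‖)
    (k : ℕ) : ‖(k : Cp)‖ ≤ 1 := by
  rw [norm_natCast_eq_padic hpadic]
  exact_mod_cast Padic.norm_int_le_one (p := p) (k : ℤ)

theorem isUltrametricDist_of_padic (hpadic : ∀ x : ℚ_[p], ‖algebraMap ℚ_[p] Cp x‖ = ‖x‖) :
    IsUltrametricDist Cp :=
  IsUltrametricDist.isUltrametricDist_of_forall_norm_natCast_le_one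
    (norm_natCast_le_one_of_padic hpadic)

theorem inv_norm_natCast_le (hpadic : ∀ x : ℚ_[p], ‖algebraMap ℚ_[p] Cp x‖ = ‖x‖)
    {k : ℕ} (hk : k ≠ 0) : ‖(k : Cp)‖⁻¹ ≤ k := by
  rw [norm_natCast_eq_padic hpadic, Padic.norm_eq_zpow_neg_valuation (by exact_mod_cast hk),
    Padic.valuation_natCast, zpow_neg, inv_inv, zpow_natCast]
  exact_mod_cast Nat.le_of_dvd (Nat.pos_of_ne_zero hk) pow_padicValNat_dvd

theorem tendsto_prime_pow_zero (hpadic : ∀ x : ℚ_[p], ‖algebraMap ℚ_[p] Cp x‖ = ‖x‖) :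
    Tendsto (fun n : ℕ => ((p ^ n : ℕ) : Cp)) atTop (nhds 0) := by
  push_cast
  refine tendsto_pow_atTop_nhds_zero_of_norm_lt_one ?_
  rw [norm_natCast_eq_padic hpadic]
  exact Padic.norm_p_lt_one

variable [CharZero Cp]

omit [Algebra ℚ_[p] Cp] in
theorem pow_sub_one_div_eq_tsum (x : Cp) {N : ℕ} (hN : N ≠ 0) :
    (x ^ N - 1) / (N : Cp) =
      ∑' k : ℕ, ((N - 1).choose k : Cp) * (x - 1) ^ (k + 1) / ((k : Cp) + 1) := by
  obtain ⟨N, rfl⟩ := Nat.exists_eq_succ_of_ne_zero hN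
  have hN0 : ((N + 1 : ℕ) : Cp) ≠ 0 := by exact_mod_cast Nat.succ_ne_zero N
  rw [tsum_eq_sum (s := Finset.range (N + 1))]
  · have hx : x ^ (N + 1) = ((x - 1) + 1) ^ (N + 1) := by ring
    rw [Nat.succ_eq_add_one, hx, add_pow, Finset.sum_range_succ']
    simp only [one_pow, mul_one, pow_zero, Nat.choose_zero_right, Nat.cast_one,
      add_sub_cancel_right, Finset.sum_div]
    refine Finset.sum_congr rfl fun k _ => ?_
    have hk : (k : Cp) + 1 ≠ 0 := by exact_mod_cast Nat.succ_ne_zero k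
    have h : ((N + 1 : ℕ) : Cp) * (N.choose k : Cp) =
        ((N + 1).choose (k + 1) : Cp) * ((k : Cp) + 1) := by
      exact_mod_cast Nat.add_one_mul_choose_eq N k
    rw [Nat.add_sub_cancel, div_eq_div_iff hN0 hk]
    linear_combination -(x - 1) ^ (k + 1) * h
  · intro k hk
    rw [Nat.choose_eq_zero_of_lt (by simpa using hk)]
    simp

theorem tendsto_choose_prime_pow (hpadic : ∀ x : ℚ_[p], ‖algebraMap ℚ_[p] Cp x‖ = ‖x‖) (k : ℕ) :
    Tendsto (fun n : ℕ => ((p ^ n - 1).choose k : Cp)) atTop (nhds ((-1) ^ k)) := by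
  induction k with
  | zero => simp
  | succ k ih =>
    have hk : (k : Cp) + 1 ≠ 0 := by exact_mod_cast Nat.succ_ne_zero k
    have h : Tendsto (fun n : ℕ => ((p ^ n - 1).choose k : Cp) *
        (((p ^ n : ℕ) : Cp) / ((k : Cp) + 1) - 1)) atTop
        (nhds ((-1) ^ k * (0 / ((k : Cp) + 1) - 1))) :=
      ih.mul (((tendsto_prime_pow_zero hpadic).div_const _).sub_const _)
    have e : (-1 : Cp) ^ k * (0 / ((k : Cp) + 1) - 1) = (-1) ^ (k + 1) := by
      rw [zero_div]; ring
    rw [e] at h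
    refine h.congr fun n => ?_
    obtain ⟨N, hN⟩ := Nat.exists_eq_succ_of_ne_zero (pow_ne_zero n (Fact.out : p.Prime).ne_zero)
    rw [hN, Nat.succ_eq_add_one, Nat.add_sub_cancel]
    have h₁ : ((N + 1 : ℕ) : Cp) * (N.choose k : Cp) =
        ((N + 1).choose (k + 1) : Cp) * ((k : Cp) + 1) := by
      exact_mod_cast Nat.add_one_mul_choose_eq N k
    have h₂ : ((N + 1).choose (k + 1) : Cp) = N.choose k + N.choose (k + 1) := by
      exact_mod_cast Nat.choose_succ_succ N k
    rw [h₂] at h₁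
    field_simp
    linear_combination h₁

theorem summable_succ_mul_pow {r : ℝ} (h0 : 0 ≤ r) (h1 : r < 1) :
    Summable fun k : ℕ => ((k : ℝ) + 1) * r ^ (k + 1) := by
  have h := summable_pow_mul_geometric_of_norm_lt_one (R := ℝ) 1 (r := r)
    (by rwa [Real.norm_of_nonneg h0])
  refine ((summable_nat_add_iff 1).2 h).congr fun k => ?_
  push_cast
  ring

omit [CharZero Cp] in
theorem norm_plog_term_le (hpadic : ∀ x : ℚ_[p], ‖algebraMap ℚ_[p] Cp x‖ = ‖x‖) {c : Cp}
    (hc : ‖c‖ ≤ 1) (z : Cp) (k : ℕ) :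
    ‖c * z ^ (k + 1) / ((k : Cp) + 1)‖ ≤ ((k : ℝ) + 1) * ‖z‖ ^ (k + 1) := by
  have h := inv_norm_natCast_le hpadic (Nat.succ_ne_zero k)
  push_cast at h
  rw [norm_div, norm_mul, norm_pow, div_eq_inv_mul]
  calc _ ≤ ((k : ℝ) + 1) * (1 * ‖z‖ ^ (k + 1)) := by gcongr
    _ = _ := by ring

variable [CompleteSpace Cp]

theorem tendsto_plog (hpadic : ∀ x : ℚ_[p], ‖algebraMap ℚ_[p] Cp x‖ = ‖x‖) {x : Cp}
    (hx : ‖x - 1‖ < 1) :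
    Tendsto (fun n : ℕ => (x ^ p ^ n - 1) / ((p ^ n : ℕ) : Cp)) atTop (nhds (plog Cp x)) := by
  have h := tendsto_tsum_of_dominated_convergence (𝓕 := atTop)
    (f := fun (n : ℕ) (k : ℕ) =>
      ((p ^ n - 1).choose k : Cp) * (x - 1) ^ (k + 1) / ((k : Cp) + 1))
    (g := fun k : ℕ => (-1) ^ k * (x - 1) ^ (k + 1) / ((k : Cp) + 1))
    (summable_succ_mul_pow (norm_nonneg (x - 1)) hx)
    (fun k => ((tendsto_choose_prime_pow hpadic k).mul_const _).div_const _)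
    (Eventually.of_forall fun n k =>
      norm_plog_term_le hpadic (norm_natCast_le_one_of_padic hpadic _) _ _)
  have e : plog Cp x = ∑' k : ℕ, (-1) ^ k * (x - 1) ^ (k + 1) / ((k : Cp) + 1) := by
    refine tsum_congr fun k => ?_
    ring
  rw [e]
  refine h.congr fun n => ?_
  exact (pow_sub_one_div_eq_tsum x (pow_ne_zero n (Fact.out : p.Prime).ne_zero)).symm

theorem tendsto_pow_prime_pow_sub_one
    (hpadic : ∀ x : ℚ_[p], ‖algebraMap ℚ_[p] Cp x‖ = ‖x‖) {x : Cp} (hx : ‖x - 1‖ < 1) :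
    Tendsto (fun n : ℕ => x ^ p ^ n - 1) atTop (nhds 0) := by
  have h := (tendsto_plog hpadic hx).mul (tendsto_prime_pow_zero hpadic)
  rw [mul_zero] at h
  refine h.congr fun n => ?_
  exact div_mul_cancel₀ _ (Nat.cast_ne_zero.2 (pow_ne_zero n (Fact.out : p.Prime).ne_zero))

omit [CharZero Cp] [CompleteSpace Cp] in
theorem norm_mul_sub_one_lt_one (hpadic : ∀ x : ℚ_[p], ‖algebraMap ℚ_[p] Cp x‖ = ‖x‖) {x y : Cp}
    (hx : ‖x - 1‖ < 1) (hy : ‖y - 1‖ < 1) : ‖x * y - 1‖ < 1 := by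
  have := isUltrametricDist_of_padic hpadic
  have e : x * y - 1 = (x - 1) * (y - 1) + ((x - 1) + (y - 1)) := by ring
  rw [e]
  refine (IsUltrametricDist.norm_add_le_max _ _).trans_lt (max_lt ?_ ?_)
  · rw [norm_mul]
    exact mul_lt_one_of_nonneg_of_lt_one_left (norm_nonneg _) hx hy.le
  · exact (IsUltrametricDist.norm_add_le_max _ _).trans_lt (max_lt hx hy)

theorem plog_mul (hpadic : ∀ x : ℚ_[p], ‖algebraMap ℚ_[p] Cp x‖ = ‖x‖) {x y : Cp}
    (hx : ‖x - 1‖ < 1) (hy : ‖y - 1‖ < 1) : plog Cp (x * y) = plog Cp x + plog Cp y := by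
  have h := tendsto_plog hpadic (norm_mul_sub_one_lt_one hpadic hx hy)
  have h' := ((tendsto_plog hpadic hx).mul (tendsto_pow_prime_pow_sub_one hpadic hy)).add
    ((tendsto_plog hpadic hx).add (tendsto_plog hpadic hy))
  rw [mul_zero, zero_add] at h'
  refine tendsto_nhds_unique h (h'.congr fun n => ?_)
  rw [mul_pow]
  ring

omit [CharZero Cp] [CompleteSpace Cp] [Algebra ℚ_[p] Cp] in
theorem plog_one : plog Cp 1 = 0 := by
  simp [plog]

theorem eq_one_of_plog_eq_zero (hpadic : ∀ x : ℚ_[p], ‖algebraMap ℚ_[p] Cp x‖ = ‖x‖) {x : Cp}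
    (hx : ‖x - 1‖ ≤ 1 / 8) (h : plog Cp x = 0) : x = 1 := by
  set z := x - 1 with hz
  have hsum : Summable fun k : ℕ => (-1) ^ (k + 1 + 1) * z ^ (k + 1) / ((k : Cp) + 1) := by
    refine Summable.of_norm_bounded
      (summable_succ_mul_pow (norm_nonneg z) (hx.trans_lt (by norm_num))) fun k => ?_
    exact norm_plog_term_le hpadic (by simp) _ _
  have := isUltrametricDist_of_padic hpadic
  have hs : plog Cp x = z + ∑' k : ℕ,
      (-1) ^ (k + 1 + 1 + 1) * z ^ (k + 1 + 1) / (((k + 1 : ℕ) : Cp) + 1) := by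
    rw [plog, hsum.tsum_eq_zero_add]
    simp
  have hle : ‖∑' k : ℕ, (-1) ^ (k + 1 + 1 + 1) * z ^ (k + 1 + 1) / (((k + 1 : ℕ) : Cp) + 1)‖ ≤
      ‖z‖ / 2 := by
    refine IsUltrametricDist.norm_tsum_le_of_forall_le_of_nonneg (by positivity) fun k => ?_
    refine (norm_plog_term_le hpadic (by simp) _ _).trans ?_
    have hk : ((k : ℝ) + 2) * (1 / 8) ^ (k + 1) ≤ 1 / 2 := by
      induction k with
      | zero => norm_num
      | succ k ih =>
        have : (0 : ℝ) ≤ (1 / 8) ^ (k + 1) := by positivity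
        rw [pow_succ]
        push_cast
        nlinarith
    calc (((k + 1 : ℕ) : ℝ) + 1) * ‖z‖ ^ (k + 1 + 1)
        = ‖z‖ * (((k : ℝ) + 2) * ‖z‖ ^ (k + 1)) := by push_cast; ring
      _ ≤ ‖z‖ * (((k : ℝ) + 2) * (1 / 8) ^ (k + 1)) := by gcongr
      _ ≤ ‖z‖ * (1 / 2) := by gcongr
      _ = ‖z‖ / 2 := by ring
  rw [h, eq_comm, add_comm, add_eq_zero_iff_eq_neg] at hs
  rw [hs, norm_neg] at hle
  have : ‖z‖ = 0 := by linarith [norm_nonneg z]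
  rwa [norm_eq_zero, hz, sub_eq_zero] at this

theorem plog_pow (hpadic : ∀ x : ℚ_[p], ‖algebraMap ℚ_[p] Cp x‖ = ‖x‖) {x : Cp}
    (hx : ‖x - 1‖ < 1) (n : ℕ) : ‖x ^ n - 1‖ < 1 ∧ plog Cp (x ^ n) = n * plog Cp x := by
  induction n with
  | zero => simp [plog_one]
  | succ n ih =>
    rw [pow_succ]
    refine ⟨norm_mul_sub_one_lt_one hpadic ih.1 hx, ?_⟩
    rw [plog_mul hpadic ih.1 hx, ih.2]
    push_cast
    ring

theorem exists_pow_eq_one_of_plog_eq_zero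
    (hpadic : ∀ x : ℚ_[p], ‖algebraMap ℚ_[p] Cp x‖ = ‖x‖) {x : Cp}
    (hx : ‖x - 1‖ < 1) (h : plog Cp x = 0) : ∃ n : ℕ, n ≠ 0 ∧ x ^ n = 1 := by
  have ht := (tendsto_pow_prime_pow_sub_one hpadic hx).norm
  rw [norm_zero] at ht
  obtain ⟨n, hn⟩ := (ht.eventually_le_const (show (0 : ℝ) < 1 / 8 by norm_num)).exists
  refine ⟨p ^ n, pow_ne_zero n (Fact.out : p.Prime).ne_zero, ?_⟩
  refine eq_one_of_plog_eq_zero hpadic hn ?_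
  rw [(plog_pow hpadic hx _).2, h, mul_zero]

end PadicLog

section NumberFieldUnits

open NumberField NumberField.Units

variable {M : Type*} [Field M] [NumberField M]

theorem units_rank_add_one_of_totallyReal (htr : ∀ (τ : M →+* ℂ) (x : M), (τ x).im = 0) :
    Units.rank M + 1 = Module.finrank ℚ M := by
  have : IsTotallyReal M := ⟨fun v => by
    rw [InfinitePlace.isReal_iff]
    ext x
    exact Complex.conj_eq_iff_im.2 (htr _ x)⟩
  have hpos : 0 < Fintype.card (InfinitePlace M) := Fintype.card_pos
  rw [Units.rank, Nat.sub_add_cancel hpos, IsTotallyReal.finrank,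
    InfinitePlace.card_eq_nrRealPlaces_add_nrComplexPlaces,
    IsTotallyReal.nrComplexPlaces_eq_zero, add_zero]

variable [IsGalois ℚ M]

theorem prod_conjugates_sq_eq_one {ε : (𝓞 M)ˣ} {u : (M ≃ₐ[ℚ] M) → (𝓞 M)ˣ}
    (hu : ∀ g, algebraMap (𝓞 M) M (u g) = g (algebraMap (𝓞 M) M ε)) :
    (∏ g, u g) ^ 2 = 1 := by
  have h : ((∏ g, u g : (𝓞 M)ˣ) : M) = algebraMap ℚ M (Algebra.norm ℚ (ε : M)) := by
    rw [Algebra.norm_eq_prod_automorphisms, Units.coe_prod, map_prod]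
    exact Finset.prod_congr rfl fun g _ => hu g
  have hn : |Algebra.norm ℚ (ε : M)| = 1 := by
    simp
  apply Units.coe_injective M
  dsimp only
  rw [Units.coe_pow, h, ← map_pow, ← sq_abs, hn]
  simp

theorem isMaxRank_conjugates {ε : (𝓞 M)ˣ} {u : (M ≃ₐ[ℚ] M) → (𝓞 M)ˣ}
    (hu : ∀ g, algebraMap (𝓞 M) M (u g) = g (algebraMap (𝓞 M) M ε))
    (hfin : (Subgroup.closure (Set.range u)).FiniteIndex)
    (e : Fin (Units.rank M) ≃ {g : M ≃ₐ[ℚ] M // g ≠ 1}) :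
    IsMaxRank fun i => u (e i) := by
  classical
  rw [isMaxRank_iff_closure_finiteIndex, finiteIndex_iff_sup_torsion_finiteIndex]
  refine @Subgroup.finiteIndex_of_le _ _ _ _ hfin ((Subgroup.closure_le _).2 ?_)
  set H := Subgroup.closure (Set.range fun i => u (e i)) ⊔ torsion M
  have hne : ∀ g, g ≠ 1 → u g ∈ H := fun g hg =>
    (le_sup_left : _ ≤ H) (Subgroup.subset_closure ⟨e.symm ⟨g, hg⟩, by simp⟩)
  rintro _ ⟨g, rfl⟩
  by_cases hg : g = 1
  · have hP : ∏ g, u g ∈ H := by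
      refine (le_sup_right : _ ≤ H) ?_
      rw [torsion, CommGroup.mem_torsion, isOfFinOrder_iff_pow_eq_one]
      exact ⟨2, two_pos, prod_conjugates_sq_eq_one hu⟩
    rw [← Finset.mul_prod_erase _ _ (Finset.mem_univ (1 : M ≃ₐ[ℚ] M))] at hP
    rw [hg]
    exact (Subgroup.mul_mem_cancel_right H
      (Subgroup.prod_mem H fun g hg => hne g (Finset.ne_of_mem_erase hg))).1 hP
  · exact hne g hg

omit [IsGalois ℚ M] in
theorem linearIndependent_int_of_isMaxRank {A : Type*} [AddCommGroup A]
    {u : Fin (Units.rank M) → (𝓞 M)ˣ} (hu : IsMaxRank u) (W : Subgroup (𝓞 M)ˣ)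
    (hW : ∀ i, u i ∈ W) (ℓ : Additive W →+ A)
    (hℓ : ∀ w, ℓ w = 0 → ∃ n : ℕ, n ≠ 0 ∧ n • w = 0) :
    LinearIndependent ℤ fun i => ℓ (Additive.ofMul ⟨u i, hW i⟩) := by
  rw [Fintype.linearIndependent_iff]
  intro c hc
  simp_rw [← map_zsmul, ← map_sum] at hc
  obtain ⟨n, hn, h⟩ := hℓ _ hc
  have h' := congrArg
    ((logEmbedding M).comp (MonoidHom.toAdditive W.subtype)) h
  rw [map_nsmul, map_sum, map_zero] at h'
  simp_rw [map_zsmul] at h'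
  have h2 := (smul_eq_zero.1 h').resolve_left hn
  intro i
  have hi := Fintype.linearIndependent_iff.1 hu (fun i => (c i : ℝ))
    (by simp only [Int.cast_smul_eq_zsmul]; exact h2) i
  exact_mod_cast hi

end NumberFieldUnits

section GroupMatrix

theorem det_ne_zero_of_algebraicIndependent {G F : Type*} [Group G] [Fintype G] [DecidableEq G]
    [Field F] [CharZero F] (y : G → F) (hsum : ∑ g, y g = 0)
    (hy : AlgebraicIndependent ℚ fun g : {g : G // g ≠ 1} => y g) :
    (Matrix.of fun h k : {g : G // g ≠ 1} => y (h * (k : G)⁻¹)).det ≠ 0 := by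
  let X : G → MvPolynomial {g : G // g ≠ 1} ℚ := fun g =>
    if hg : g = 1 then -∑ k, MvPolynomial.X k else MvPolynomial.X ⟨g, hg⟩
  let D : Matrix {g : G // g ≠ 1} {g : G // g ≠ 1} (MvPolynomial {g : G // g ≠ 1} ℚ) :=
    Matrix.of fun h k => X (h * (k : G)⁻¹)
  have hX : ∀ g, MvPolynomial.aeval (fun g : {g : G // g ≠ 1} => y g) (X g) = y g := by
    intro g
    by_cases hg : g = 1
    · subst hg
      have h := Fintype.sum_eq_add_sum_subtype_ne y 1
      rw [hsum] at h
      simp only [X, dif_pos, map_neg, map_sum, MvPolynomial.aeval_X]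
      linear_combination h
    · simp [X, hg]
  have hD : D.det ≠ 0 := by
    intro h0
    have h := congrArg (MvPolynomial.aeval (R := ℚ) fun _ : {g : G // g ≠ 1} => (-1 : ℝ)) h0
    rw [map_zero, AlgHom.map_det] at h
    revert h
    refine det_ne_zero_of_sum_row_lt_diag fun k => ?_
    have hdiag : ((MvPolynomial.aeval fun _ : {g : G // g ≠ 1} => (-1 : ℝ)).mapMatrix D) k k =
        Fintype.card {g : G // g ≠ 1} := by
      simp [D, X]
    have hoff : ∀ j ∈ Finset.univ.erase k,
        ‖((MvPolynomial.aeval fun _ : {g : G // g ≠ 1} => (-1 : ℝ)).mapMatrix D) k j‖ = 1 := by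
      intro j hj
      have : (k : G) * (j : G)⁻¹ ≠ 1 := fun h =>
        Finset.ne_of_mem_erase hj (Subtype.ext (mul_inv_eq_one.1 h).symm)
      simp [D, X, this]
    rw [Finset.sum_congr rfl hoff, hdiag, Finset.sum_const, Real.norm_natCast, nsmul_one]
    exact_mod_cast Finset.card_erase_lt_of_mem (Finset.mem_univ k)
  intro h0
  refine hD ((injective_iff_map_eq_zero _).1 hy _ ?_)
  rw [AlgHom.map_det, ← h0]
  congr 1
  ext h k
  simp [D, hX]

end GroupMatrix

section PadicLogMatrix

open NumberField NumberField.Units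

theorem linearIndependent_plog {p : ℕ} [Fact p.Prime] {Cp : Type*} [NormedField Cp]
    [CompleteSpace Cp] [CharZero Cp] [Algebra ℚ_[p] Cp]
    (hpadic : ∀ x : ℚ_[p], ‖algebraMap ℚ_[p] Cp x‖ = ‖x‖)
    {M : Type*} [Field M] [NumberField M] (σ : M →+* Cp)
    {u : Fin (Units.rank M) → (𝓞 M)ˣ} (hu : IsMaxRank u)
    (hloc : ∀ i, ‖σ (algebraMap (𝓞 M) M (u i)) - 1‖ < 1) :
    LinearIndependent ℚ fun i => plog Cp (σ (algebraMap (𝓞 M) M (u i))) := by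
  have hult := isUltrametricDist_of_padic hpadic
  let W : Subgroup (𝓞 M)ˣ :=
    { carrier := {v | ‖σ (algebraMap (𝓞 M) M v) - 1‖ < 1}
      one_mem' := by simp
      mul_mem' := fun {a b} ha hb => by
        simpa using norm_mul_sub_one_lt_one hpadic ha hb
      inv_mem' := fun {a} ha => by
        have h1 : σ (algebraMap (𝓞 M) M a) * σ (algebraMap (𝓞 M) M (a⁻¹ : (𝓞 M)ˣ)) = 1 := by
          rw [← map_mul, ← map_mul, Units.mul_inv, map_one, map_one]
        have h2 : ‖σ (algebraMap (𝓞 M) M a)‖ = 1 := by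
          have := IsUltrametricDist.norm_add_eq_max_of_norm_ne_norm
            (x := σ (algebraMap (𝓞 M) M a) - 1) (y := 1) (by rw [norm_one]; exact ne_of_lt ha)
          rw [sub_add_cancel, norm_one] at this
          rw [this]
          exact max_eq_right (le_of_lt ha)
        have h3 : σ (algebraMap (𝓞 M) M (a⁻¹ : (𝓞 M)ˣ)) - 1 =
            -(σ (algebraMap (𝓞 M) M (a⁻¹ : (𝓞 M)ˣ)) * (σ (algebraMap (𝓞 M) M a) - 1)) := by
          linear_combination h1
        have h4 := congrArg norm h1
        rw [norm_mul, h2, one_mul, norm_one] at h4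
        change ‖_‖ < 1
        rw [h3, norm_neg, norm_mul, h4, one_mul]
        exact ha }
  let ℓ : Additive W →+ Cp := AddMonoidHom.mk'
    (fun w => plog Cp (σ (algebraMap (𝓞 M) M (w.toMul : (𝓞 M)ˣ)))) fun a b => by
      simpa using plog_mul hpadic a.toMul.2 b.toMul.2
  rw [← LinearIndependent.iff_fractionRing ℤ ℚ]
  refine linearIndependent_int_of_isMaxRank hu W hloc ℓ fun w hw => ?_
  obtain ⟨n, hn, h⟩ := exists_pow_eq_one_of_plog_eq_zero hpadic w.toMul.2 hw
  refine ⟨n, hn, ?_⟩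
  have h' : w.toMul ^ n = 1 := by
    apply Subtype.ext
    apply Units.coe_injective M
    apply σ.injective
    simpa using h
  exact congrArg Additive.ofMul h'

theorem bijective_comp_galois {M Cp : Type*} [Field M] [NumberField M] [IsGalois ℚ M] [Field Cp]
    [CharZero Cp] [IsAlgClosed Cp] (σ : M →+* Cp) :
    Function.Bijective fun h : M ≃ₐ[ℚ] M => σ.comp (h : M →+* M) := by
  rw [Fintype.bijective_iff_injective_and_card]
  refine ⟨fun a b hab => ?_, ?_⟩
  · ext x
    exact σ.injective (RingHom.congr_fun hab x)
  · rw [NumberField.Embeddings.card, ← IsGalois.card_aut_eq_finrank, Nat.card_eq_fintype_card]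

theorem Matrix.card_le_rank_of_linearIndependent {m n k K : Type*} [Finite m] [Fintype n]
    [Fintype k] [Field K] (A : Matrix m n K) (f : k → m)
    (h : LinearIndependent K fun i => A (f i)) : Fintype.card k ≤ A.rank := by
  rw [A.rank_eq_finrank_span_row, ← finrank_span_eq_card h]
  exact Submodule.finrank_mono (Submodule.span_mono (Set.range_comp_subset_range f A))

theorem Matrix.rank_lt_card_of_mulVec_eq_zero {m n K : Type*} [Fintype n] [Field K]
    (A : Matrix m n K) {v : n → K} (hv : v ≠ 0) (h : A.mulVec v = 0) : A.rank < Fintype.card n := by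
  have hr := LinearMap.finrank_range_add_finrank_ker A.mulVecLin
  have hpos : 0 < Module.finrank K (LinearMap.ker A.mulVecLin) := by
    have : Nontrivial (LinearMap.ker A.mulVecLin) :=
      ⟨⟨⟨v, h⟩, 0, fun h0 => hv (congrArg Subtype.val h0)⟩⟩
    exact Module.finrank_pos
  rw [Module.finrank_fintype_fun_eq_card] at hr
  rw [Matrix.rank]
  lia

end PadicLogMatrix

/-- Suppose `M` is totally real, and let `t = |E_p ∖ S_p|`. Assuming the
`p`-adic Schanuel conjecture, the rank of the `p`-adic log matrix over `S_p × G` equals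
`r − (t−1)⁺`. -/
theorem stmt4 (p : ℕ) [Fact p.Prime]
    (Cp : Type*) [NormedField Cp] [CompleteSpace Cp] [IsAlgClosed Cp] [CharZero Cp]
    [Algebra ℚ_[p] Cp] (hpadic : ∀ x : ℚ_[p], ‖algebraMap ℚ_[p] Cp x‖ = ‖x‖)
    (hiso : Nonempty (Cp ≃+* ℂ))
    (M : Type*) [Field M] [NumberField M] [IsGalois ℚ M]
    (htr : ∀ (τ : M →+* ℂ) (x : M), (τ x).im = 0)
    (Sp : Set (M →+* Cp))
    (ε : (𝓞 M)ˣ) (hWM : IsWeakMinkowskiUnit M ε)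
    (hloc : ∀ (σ : M →+* Cp) (g : M ≃ₐ[ℚ] M), ‖σ (g (algebraMap (𝓞 M) M ε)) - 1‖ < 1)
    (hSch : PadicSchanuel Cp) :
    ((padicLogMatrix Cp M Sp (algebraMap (𝓞 M) M ε)).rank : ℤ) =
      (NumberField.Units.rank M : ℤ) - max ((Set.ncard Spᶜ : ℤ) - 1) 0 := by
  classical
  obtain ⟨u, hu, hfin⟩ := hWM
  set x : M := algebraMap (𝓞 M) M ε
  have hr := units_rank_add_one_of_totallyReal htr
  have hcard : Fintype.card (M ≃ₐ[ℚ] M) = NumberField.Units.rank M + 1 := by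
    rw [hr, ← IsGalois.card_aut_eq_finrank, Nat.card_eq_fintype_card]
  have hcard' : Fintype.card {g : M ≃ₐ[ℚ] M // g ≠ 1} = NumberField.Units.rank M := by
    rw [Fintype.card_subtype_compl, Fintype.card_subtype_eq, hcard, Nat.add_sub_cancel]
  let e : Fin (NumberField.Units.rank M) ≃ {g : M ≃ₐ[ℚ] M // g ≠ 1} :=
    (Fintype.equivFinOfCardEq hcard').symm
  have hmax := isMaxRank_conjugates hu hfin e
  have hsum : ∀ σ : M →+* Cp, ∑ g : M ≃ₐ[ℚ] M, plog Cp (σ (g x)) = 0 := by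
    intro σ
    have hprod : ∀ s : Finset (M ≃ₐ[ℚ] M), ‖∏ g ∈ s, σ ((g : M ≃ₐ[ℚ] M) x) - 1‖ < 1 ∧
        plog Cp (∏ g ∈ s, σ ((g : M ≃ₐ[ℚ] M) x)) = ∑ g ∈ s, plog Cp (σ (g x)) := by
      intro s
      induction s using Finset.induction_on with
      | empty => simp [plog_one]
      | insert a s ha ih =>
        rw [Finset.prod_insert ha, Finset.sum_insert ha, ← ih.2]
        exact ⟨norm_mul_sub_one_lt_one hpadic (hloc σ a) ih.1,
          plog_mul hpadic (hloc σ a) ih.1⟩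
    obtain ⟨h1, h2⟩ := hprod Finset.univ
    have hsq : (∏ g : M ≃ₐ[ℚ] M, σ (g x)) ^ 2 = 1 := by
      have h := congrArg (fun v : (𝓞 M)ˣ => σ (algebraMap (𝓞 M) M v))
        (prod_conjugates_sq_eq_one hu)
      simpa [hu, map_prod] using h
    have h3 := (plog_pow hpadic h1 2).2
    rw [hsq, plog_one, h2] at h3
    simpa using h3.symm
  have key : ∀ σ : M →+* Cp, LinearIndependent Cp
      fun h : {h : M ≃ₐ[ℚ] M // h ≠ 1} => fun g : M ≃ₐ[ℚ] M => plog Cp (σ (h.1 (g x))) := by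
    intro σ
    have hlocu : ∀ i, ‖σ (algebraMap (𝓞 M) M (u (e i))) - 1‖ < 1 := fun i => by
      rw [hu]
      exact hloc σ _
    have hlin := linearIndependent_plog hpadic σ hmax hlocu
    have halg := hSch _ _ (fun i => IsAlgebraic.algHom σ.toRatAlgHom
      (Algebra.IsAlgebraic.isAlgebraic (algebraMap (𝓞 M) M (u (e i))))) hlocu hlin
    have hy : AlgebraicIndependent ℚ
        fun g : {g : M ≃ₐ[ℚ] M // g ≠ 1} => plog Cp (σ (g.1 x)) := by
      have := halg.comp e.symm e.symm.injective
      convert this using 2 with g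
      simp [hu, x]
    have hdet := det_ne_zero_of_algebraicIndependent
      (fun g : M ≃ₐ[ℚ] M => plog Cp (σ (g x))) (hsum σ) hy
    have hrows := Matrix.linearIndependent_rows_of_det_ne_zero hdet
    exact LinearIndependent.of_comp (LinearMap.funLeft Cp Cp
      fun k : {k : M ≃ₐ[ℚ] M // k ≠ 1} => (k.1)⁻¹) hrows
  have hncard : Sp.ncard + Spᶜ.ncard = NumberField.Units.rank M + 1 := by
    rw [Set.ncard_add_ncard_compl, Nat.card_eq_fintype_card, NumberField.Embeddings.card, hr]
  by_cases hSp : Sp = Set.univ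
  · subst hSp
    obtain ⟨σ⟩ : Nonempty (M →+* Cp) := inferInstance
    have h1 := Matrix.card_le_rank_of_linearIndependent (padicLogMatrix Cp M Set.univ x)
      (fun h : {h : M ≃ₐ[ℚ] M // h ≠ 1} => ⟨σ.comp (h.1 : M →+* M), Set.mem_univ _⟩) (key σ)
    have h2 := Matrix.rank_lt_card_of_mulVec_eq_zero (padicLogMatrix Cp M Set.univ x)
      (v := 1) one_ne_zero (by
        ext τ
        simpa [Matrix.mulVec, dotProduct, padicLogMatrix] using hsum τ.1)
    rw [hcard'] at h1
    rw [hcard] at h2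
    simp only [Set.compl_univ, Set.ncard_empty]
    lia
  · obtain ⟨σ, hσ⟩ := (Set.ne_univ_iff_exists_notMem Sp).1 hSp
    let E := Equiv.ofBijective _ (bijective_comp_galois (M := M) σ)
    have hE : ∀ τ, σ.comp ((E.symm τ : M ≃ₐ[ℚ] M) : M →+* M) = τ := E.apply_symm_apply
    let f : Sp → {h : M ≃ₐ[ℚ] M // h ≠ 1} := fun τ => ⟨E.symm τ.1, fun h => hσ (by
      have h' := hE τ.1
      rw [h] at h'
      have h1 : σ = τ.1 := h'
      rw [h1]
      exact τ.2)⟩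
    have hf : Function.Injective f := fun a b hab =>
      Subtype.ext (E.symm.injective (congrArg Subtype.val hab))
    have hrow : LinearIndependent Cp (padicLogMatrix Cp M Sp x).row := by
      have h := (key σ).comp f hf
      convert h using 1
      ext τ g
      exact congrArg (plog Cp) (RingHom.congr_fun (hE τ.1) (g x)).symm
    have hpos : 0 < Spᶜ.ncard := (Set.ncard_pos).2 ⟨σ, hσ⟩
    rw [hrow.rank_matrix, ← Nat.card_eq_fintype_card, Nat.card_coe_set_eq]
    lia
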